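/- Let τ ∈ (0, (1+√5)/2), suppose ½Σ̂_f + 𝒮 + σ𝒜𝒜* ≻ 0 and ½Σ̂_g + 𝒯 + σℬℬ* ≻ 0, and let {(y^k, z^k, x^k)}_{k≥0} be a sequence generated by the majorized iPADMM. Then the sequence u^k = (y^k, z^k, x^k) converges to a KKT point u^∞ = (y^∞, z^∞, x^∞) ∈ Ω̄; in particular (y^∞, z^∞) is an optimal solution of the problem minimize p(y) + f(y) + q(z) + g(z) subject to 𝒜*y + ℬ*z = c. -/

import Mathlib

open scoped RealInnerProductSpace

noncomputable section

/-- the quadratic form `‖w‖²_M := ⟨w, M w⟩` of a linear operator. -/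
def quadForm {E : Type*} [NormedAddCommGroup E] [InnerProductSpace ℝ E]
    (M : E →ₗ[ℝ] E) (w : E) : ℝ := ⟪w, M w⟫

/-- convexity of a function with values in `ℝ ∪ {±∞}`. -/
def ERConvex {E : Type*} [AddCommGroup E] [Module ℝ E] (p : E → EReal) : Prop :=
  ∀ x y : E, ∀ a b : ℝ, 0 ≤ a → 0 ≤ b → a + b = 1 →
    p (a • x + b • y) ≤ (a : EReal) * p x + (b : EReal) * p y

/-- properness of a function with values in `ℝ ∪ {±∞}`: nowhere `−∞`, somewhere finite. -/
def ERProper {E : Type*} (p : E → EReal) : Prop :=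
  (∃ x, p x ≠ ⊤) ∧ ∀ x, p x ≠ ⊥

/-- `g` belongs to the convex subdifferential `∂p(x)`. -/
def ERSubgrad {E : Type*} [NormedAddCommGroup E] [InnerProductSpace ℝ E]
    (p : E → EReal) (x g : E) : Prop :=
  ∀ w, p x + ((⟪g, w - x⟫ : ℝ) : EReal) ≤ p w

/-- the set `Ω̄` of KKT points of the problem `min p(y) + f(y) + q(z) + g(z)`
subject to `𝒜*y + ℬ*z = c`. -/
def KKTset {X Y Z : Type*}
    [NormedAddCommGroup X] [InnerProductSpace ℝ X] [FiniteDimensional ℝ X]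
    [NormedAddCommGroup Y] [InnerProductSpace ℝ Y] [FiniteDimensional ℝ Y]
    [NormedAddCommGroup Z] [InnerProductSpace ℝ Z] [FiniteDimensional ℝ Z]
    (A : X →ₗ[ℝ] Y) (B : X →ₗ[ℝ] Z) (c : X)
    (gradf : Y → Y) (gradg : Z → Z) (p : Y → EReal) (q : Z → EReal) :
    Set (Y × Z × X) :=
  {u | ERSubgrad p u.1 (-(gradf u.1 + A u.2.2)) ∧
       ERSubgrad q u.2.1 (-(gradg u.2.1 + B u.2.2)) ∧
       LinearMap.adjoint A u.1 + LinearMap.adjoint B u.2.1 = c}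

section QuadForm

variable {E : Type*} [NormedAddCommGroup E] [InnerProductSpace ℝ E]

lemma quadForm_zero (M : E →ₗ[ℝ] E) : quadForm M 0 = 0 := by
  simp [quadForm]

lemma quadForm_neg (M : E →ₗ[ℝ] E) (w : E) : quadForm M (-w) = quadForm M w := by
  simp [quadForm]

lemma quadForm_add_apply (M N : E →ₗ[ℝ] E) (w : E) :
    quadForm (M + N) w = quadForm M w + quadForm N w := by
  simp [quadForm, inner_add_right]

lemma quadForm_smul_apply (a : ℝ) (M : E →ₗ[ℝ] E) (w : E) :
    quadForm (a • M) w = a * quadForm M w := by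
  simp [quadForm, inner_smul_right]

lemma quadForm_smul (M : E →ₗ[ℝ] E) (t : ℝ) (w : E) :
    quadForm M (t • w) = t ^ 2 * quadForm M w := by
  simp only [quadForm, map_smul, inner_smul_left, inner_smul_right, conj_trivial]
  ring

lemma LinearMap.IsSymmetric.quadForm_add {M : E →ₗ[ℝ] E} (hM : M.IsSymmetric) (v w : E) :
    quadForm M (v + w) = quadForm M v + 2 * ⟪M v, w⟫ + quadForm M w := by
  have h1 : ⟪v, M w⟫ = ⟪M v, w⟫ := (hM v w).symm
  have h2 : ⟪w, M v⟫ = ⟪M v, w⟫ := real_inner_comm _ _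
  simp only [quadForm, map_add, inner_add_left, inner_add_right, h1, h2]
  ring

lemma LinearMap.IsSymmetric.quadForm_sub {M : E →ₗ[ℝ] E} (hM : M.IsSymmetric) (v w : E) :
    quadForm M (v - w) = quadForm M v - 2 * ⟪M v, w⟫ + quadForm M w := by
  rw [sub_eq_add_neg, hM.quadForm_add, quadForm_neg, inner_neg_right]
  ring

lemma LinearMap.IsSymmetric.inner_map_sub_sub {M : E →ₗ[ℝ] E} (hM : M.IsSymmetric)
    (a b o : E) : ⟪M (b - a), b - o⟫
      = 1 / 2 * (quadForm M (b - o) + quadForm M (b - a) - quadForm M (a - o)) := by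
  have h := hM.quadForm_sub (b - a) (b - o)
  have e : b - a - (b - o) = -(a - o) := by abel
  rw [e, quadForm_neg] at h
  linarith

lemma quadForm_comp_adjoint {F : Type*} [NormedAddCommGroup F] [InnerProductSpace ℝ F]
    [FiniteDimensional ℝ E] [FiniteDimensional ℝ F] (A : F →ₗ[ℝ] E) (w : E) :
    quadForm (A ∘ₗ LinearMap.adjoint A) w = ‖LinearMap.adjoint A w‖ ^ 2 := by
  rw [quadForm, LinearMap.comp_apply, ← LinearMap.adjoint_inner_left, real_inner_self_eq_norm_sq]

lemma continuous_quadForm [FiniteDimensional ℝ E] (M : E →ₗ[ℝ] E) :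
    Continuous (quadForm M) :=
  continuous_id.inner M.continuous_of_finiteDimensional

/-- A positive definite operator on a finite-dimensional space is coercive. -/
lemma exists_mul_norm_sq_le_quadForm [FiniteDimensional ℝ E] {M : E →ₗ[ℝ] E}
    (hM : ∀ w, w ≠ 0 → 0 < quadForm M w) :
    ∃ m : ℝ, 0 < m ∧ ∀ w, m * ‖w‖ ^ 2 ≤ quadForm M w := by
  have : ProperSpace E := FiniteDimensional.proper ℝ E
  rcases (Metric.sphere (0 : E) 1).eq_empty_or_nonempty with hemp | hne
  · refine ⟨1, one_pos, fun w => ?_⟩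
    have hw : w = 0 := by
      by_contra hw
      have : (‖w‖⁻¹ • w) ∈ Metric.sphere (0 : E) 1 := by
        simp [norm_smul, hw]
      simp [hemp] at this
    simp [hw, quadForm_zero]
  · obtain ⟨v, hv, hmin⟩ := (isCompact_sphere (0 : E) 1).exists_isMinOn hne
      (continuous_quadForm M).continuousOn
    have hv0 : v ≠ 0 := by
      rintro rfl
      simp at hv
    refine ⟨quadForm M v, hM v hv0, fun w => ?_⟩
    by_cases hw : w = 0
    · simp [hw, quadForm_zero]
    have hmem : (‖w‖⁻¹ • w) ∈ Metric.sphere (0 : E) 1 := by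
      simp [norm_smul, hw]
    have h := hmin hmem
    simp only [Set.mem_ofPred_eq, quadForm_smul] at h
    have hpos : 0 < ‖w‖ ^ 2 := by positivity
    calc quadForm M v * ‖w‖ ^ 2 ≤ (‖w‖⁻¹ ^ 2 * quadForm M w) * ‖w‖ ^ 2 := by gcongr
      _ = quadForm M w := by field_simp

/-- If `f` lies above its linearizations and below its quadratic majorants, then its gradient
satisfies a three-point form of cocoercivity. -/
lemma three_point_gradient_bound {f : E → ℝ} {gradf : E → E} {M : E →ₗ[ℝ] E}
    (hlow : ∀ w w', f w' + ⟪gradf w', w - w'⟫ ≤ f w)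
    (hup : ∀ w w', f w ≤ f w' + ⟪gradf w', w - w'⟫ + 1 / 2 * quadForm M (w - w'))
    (u v w : E) :
    -(1 / 4) * quadForm M (w - u) ≤ ⟪gradf u - gradf v, w - v⟫ := by
  set d := (1 / 2 : ℝ) • (w - u) with hd
  have hw : w - v = (u - v) + (2 : ℝ) • d := by
    rw [hd, smul_smul]; norm_num
  have hq : quadForm M d = 1 / 4 * quadForm M (w - u) := by
    rw [hd, quadForm_smul]; norm_num
  have h1 := (hlow (u + d) v).trans (hup (u + d) u)
  have h2 := (hlow (v - d) u).trans (hup (v - d) v)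
  have e1 : u + d - u = d := by abel
  have e2 : v - d - v = -d := by abel
  have e3 : u + d - v = (u - v) + d := by abel
  have e4 : v - d - u = -((u - v) + d) := by abel
  rw [e1, e3] at h1
  rw [e2, e4, quadForm_neg] at h2
  simp only [inner_add_right, inner_neg_right] at h1 h2
  rw [hw]
  simp only [inner_sub_left, inner_add_right, inner_smul_right]
  linarith

/-- Successive gradient differences, corrected by an indefinite proximal operator, are controlled
by the quadratic form of `M + T`. -/
lemma inner_proximal_gradient_bound {f : E → ℝ} {gradf : E → E} {M T : E →ₗ[ℝ] E}
    (hMs : M.IsSymmetric) (hTs : T.IsSymmetric)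
    (hT : ∀ w, -(1 / 2) * quadForm M w ≤ quadForm T w)
    (hlow : ∀ w w', f w' + ⟪gradf w', w - w'⟫ ≤ f w)
    (hup : ∀ w w', f w ≤ f w' + ⟪gradf w', w - w'⟫ + 1 / 2 * quadForm M (w - w'))
    (u v b : E) :
    -(1 / 2) * (quadForm (M + T) (u - v) + quadForm (M + T) b) ≤
      ⟪gradf u - gradf v, b⟫ - ⟪(M + T) (u - v), b⟫ := by
  have h1 := three_point_gradient_bound hlow hup u v (v + b)
  have e1 : v + b - u = -((u - v) - b) := by abel
  rw [e1, quadForm_neg, hMs.quadForm_sub, add_sub_cancel_left] at h1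
  have h2 := hT ((u - v) - b)
  rw [hMs.quadForm_sub, hTs.quadForm_sub] at h2
  rw [quadForm_add_apply, quadForm_add_apply, LinearMap.add_apply, inner_add_left]
  linarith

end QuadForm

section Subgradient

variable {E : Type*} [NormedAddCommGroup E] [InnerProductSpace ℝ E]

lemma ERSubgrad.ne_top {p : E → EReal} (hp : ERProper p) {x g : E} (h : ERSubgrad p x g) :
    p x ≠ ⊤ := by
  intro hx
  obtain ⟨w, hw⟩ := hp.1
  have := h w
  rw [hx, EReal.top_add_coe] at this
  exact hw (top_le_iff.mp this)

lemma ERSubgrad.toReal_le {p : E → EReal} (hp : ERProper p) {x g : E} (h : ERSubgrad p x g)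
    {w : E} (hw : p w ≠ ⊤) : (p x).toReal + ⟪g, w - x⟫ ≤ (p w).toReal := by
  have h' := h w
  rw [← EReal.coe_toReal (h.ne_top hp) (hp.2 x), ← EReal.coe_toReal hw (hp.2 w)] at h'
  exact_mod_cast h'

/-- Monotonicity of the subdifferential. -/
lemma ERSubgrad.inner_nonneg {p : E → EReal} (hp : ERProper p) {x g x' g' : E}
    (h : ERSubgrad p x g) (h' : ERSubgrad p x' g') : 0 ≤ ⟪g - g', x - x'⟫ := by
  have h1 := h.toReal_le hp (h'.ne_top hp)
  have h2 := h'.toReal_le hp (h.ne_top hp)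
  rw [← neg_sub x x', inner_neg_right] at h1
  rw [inner_sub_left]
  linarith

open Filter Topology in
/-- The graph of the subdifferential of a closed function is closed. -/
lemma ERSubgrad.of_tendsto {p : E → EReal} (hp : ERProper p) (hlsc : LowerSemicontinuous p)
    {u v : ℕ → E} {x g : E} (h : ∀ k, ERSubgrad p (u k) (v k))
    (hu : Tendsto u atTop (𝓝 x)) (hv : Tendsto v atTop (𝓝 g)) : ERSubgrad p x g := by
  intro w
  by_cases hw : p w = ⊤
  · simp [hw]
  have hbound : ∀ k, p (u k) ≤ (((p w).toReal - ⟪v k, w - u k⟫ : ℝ) : EReal) := by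
    intro k
    rw [← EReal.coe_toReal ((h k).ne_top hp) (hp.2 _), EReal.coe_le_coe_iff]
    have := (h k).toReal_le hp hw
    linarith
  have hlim : Tendsto (fun k => (((p w).toReal - ⟪v k, w - u k⟫ : ℝ) : EReal)) atTop
      (𝓝 (((p w).toReal - ⟪g, w - x⟫ : ℝ) : EReal)) := by
    refine (continuous_coe_real_ereal.tendsto _).comp ?_
    exact tendsto_const_nhds.sub (hv.inner (tendsto_const_nhds.sub hu))
  have hx : p x ≤ (((p w).toReal - ⟪g, w - x⟫ : ℝ) : EReal) := by
    refine le_of_forall_lt fun a ha => ?_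
    obtain ⟨b, hab, hb⟩ := exists_between ha
    refine hab.trans_le (ge_of_tendsto hlim ?_)
    filter_upwards [hu.eventually (hlsc x b hb)] with k hk
    exact hk.le.trans (hbound k)
  have hxt : p x ≠ ⊤ := fun ht => by
    rw [ht] at hx
    exact EReal.coe_ne_top _ (top_le_iff.mp hx)
  rw [← EReal.coe_toReal hxt (hp.2 x)] at hx ⊢
  rw [← EReal.coe_toReal hw (hp.2 w)]
  rw [EReal.coe_le_coe_iff] at hx
  rw [← EReal.coe_add, EReal.coe_le_coe_iff]
  linarith

/-- First-order optimality for a proximal augmented-Lagrangian subproblem. -/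
lemma ERSubgrad.of_isMin {F : Type*} [NormedAddCommGroup F] [InnerProductSpace ℝ F]
    [FiniteDimensional ℝ E] [FiniteDimensional ℝ F] {p : E → EReal}
    (hp : ERProper p) (hconv : ERConvex p) (A : F →ₗ[ℝ] E) {M : E →ₗ[ℝ] E}
    (hM : M.IsSymmetric) (a : E) (b : F) (u₀ : E) (σ : ℝ) {u : E} (hu : p u ≠ ⊤)
    (hmin : ∀ w, p u + ((⟪u, a⟫ + σ / 2 * ‖LinearMap.adjoint A u + b‖ ^ 2
          + 1 / 2 * quadForm M (u - u₀) : ℝ) : EReal)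
        ≤ p w + ((⟪w, a⟫ + σ / 2 * ‖LinearMap.adjoint A w + b‖ ^ 2
          + 1 / 2 * quadForm M (w - u₀) : ℝ) : EReal)) :
    ERSubgrad p u (-(a + σ • A (LinearMap.adjoint A u + b) + M (u - u₀))) := by
  intro w
  by_cases hw : p w = ⊤
  · simp [hw]
  set G := a + σ • A (LinearMap.adjoint A u + b) + M (u - u₀) with hG
  set C := σ / 2 * ‖LinearMap.adjoint A (w - u)‖ ^ 2 + 1 / 2 * quadForm M (w - u) with hC
  have key : ∀ t : ℝ, 0 < t → t ≤ 1 →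
      (p u).toReal ≤ (p w).toReal + ⟪G, w - u⟫ + t * C := by
    intro t ht ht1
    have hcv := hconv u w (1 - t) t (by linarith) ht.le (by ring)
    have hm := hmin ((1 - t) • u + t • w)
    rw [← EReal.coe_toReal hu (hp.2 u), ← EReal.coe_toReal hw (hp.2 w), ← EReal.coe_mul,
      ← EReal.coe_mul, ← EReal.coe_add] at hcv
    have hvt : p ((1 - t) • u + t • w) ≠ ⊤ := fun h => by
      rw [h] at hcv
      exact EReal.coe_ne_top _ (top_le_iff.mp hcv)
    rw [← EReal.coe_toReal hvt (hp.2 _), EReal.coe_le_coe_iff] at hcv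
    rw [← EReal.coe_toReal hu (hp.2 u), ← EReal.coe_toReal hvt (hp.2 _), ← EReal.coe_add,
      ← EReal.coe_add, EReal.coe_le_coe_iff] at hm
    have e0 : (1 - t) • u + t • w = u + t • (w - u) := by
      rw [sub_smul, smul_sub, one_smul]; abel
    have e1 : LinearMap.adjoint A (u + t • (w - u)) + b
        = (LinearMap.adjoint A u + b) + t • LinearMap.adjoint A (w - u) := by
      rw [map_add, map_smul]; abel
    have e2 : u + t • (w - u) - u₀ = (u - u₀) + t • (w - u) := by abel
    rw [e0] at hm hcv
    have e3 : ‖LinearMap.adjoint A u + b + t • LinearMap.adjoint A (w - u)‖ ^ 2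
        = ‖LinearMap.adjoint A u + b‖ ^ 2
          + 2 * (t * ⟪A (LinearMap.adjoint A u + b), w - u⟫)
          + t ^ 2 * ‖LinearMap.adjoint A (w - u)‖ ^ 2 := by
      rw [norm_add_sq_real, norm_smul, mul_pow, Real.norm_eq_abs, sq_abs, inner_smul_right,
        LinearMap.adjoint_inner_right]
    rw [e1, e2, e3, hM.quadForm_add, quadForm_smul, inner_add_left, inner_smul_right,
      inner_smul_left, conj_trivial, real_inner_comm a (w - u)] at hm
    have hGi : ⟪G, w - u⟫ = ⟪a, w - u⟫ + σ * ⟪A (LinearMap.adjoint A u + b), w - u⟫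
        + ⟪M (u - u₀), w - u⟫ := by
      rw [hG, inner_add_left, inner_add_left, inner_smul_left, conj_trivial]
    have hmul : t * (p u).toReal ≤ t * ((p w).toReal + ⟪G, w - u⟫ + t * C) := by
      rw [hGi, hC]
      linarith
    exact le_of_mul_le_mul_left hmul ht
  have hlim : (p u).toReal ≤ (p w).toReal + ⟪G, w - u⟫ := by
    refine le_of_forall_pos_le_add fun δ hδ => ?_
    set t := min 1 (δ / (|C| + 1)) with htdef
    have ht : 0 < t := lt_min one_pos (by positivity)
    have h := key t ht (min_le_left _ _)
    have hb : t * C ≤ δ := by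
      calc t * C ≤ t * (|C| + 1) := by
            gcongr
            linarith [le_abs_self C]
        _ ≤ δ / (|C| + 1) * (|C| + 1) := by
            gcongr
            exact min_le_right _ _
        _ = δ := by field_simp
    linarith
  rw [← EReal.coe_toReal hu (hp.2 u), ← EReal.coe_toReal hw (hp.2 w), ← EReal.coe_add,
    EReal.coe_le_coe_iff, inner_neg_left]
  linarith

end Subgradient

/-- The dual step lengths below the golden ratio are those for which the residual cross terms of
the alternating scheme can be absorbed. -/
lemma exists_absorbing_constants {τ : ℝ} (h0 : 0 < τ) (h1 : τ < (1 + Real.sqrt 5) / 2) :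
    ∃ β ε : ℝ, 0 < β ∧ 0 < ε ∧ β + ε ≤ 2 - τ ∧ (τ - 1) ^ 2 ≤ (1 - ε) * β := by
  have h5 : Real.sqrt 5 ^ 2 = 5 := Real.sq_sqrt (by norm_num)
  have h5' : 0 ≤ Real.sqrt 5 := Real.sqrt_nonneg 5
  have hgap : 0 < 2 - τ - (τ - 1) ^ 2 := by
    by_cases hc : τ ≤ 1
    · nlinarith
    · nlinarith
  refine ⟨(τ - 1) ^ 2 + (2 - τ - (τ - 1) ^ 2) / 2, (2 - τ - (τ - 1) ^ 2) / 4, by positivity,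
    by positivity, by linarith, ?_⟩
  nlinarith [sq_nonneg (τ - 1)]

/-- The Lyapunov decrease of one step of the alternating scheme, in terms of the images of the
errors in the multiplier space and the values of the proximal quadratic forms. -/
lemma lyapunov_decrease {X : Type*} [NormedAddCommGroup X] [InnerProductSpace ℝ X]
    {σ τ β ε : ℝ} (hσ : 0 < σ) (hτ : 0 < τ) (hβ : 0 < β) (hβε : β + ε ≤ 2 - τ)
    (hε : (τ - 1) ^ 2 ≤ (1 - ε) * β) {ξ ξ' α b b' r r' : X}
    {Py Py' Pd Fd Qz Qz' Qd Qd' Gd : ℝ}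
    (hr' : r' = α + b') (hξ : ξ' = ξ + (τ * σ) • r')
    (hY : ⟪ξ + σ • (α + b), α⟫ + 1 / 2 * (Py' + Pd - Py) ≤ 1 / 4 * Fd)
    (hZ : ⟪ξ + σ • r', b'⟫ + 1 / 2 * (Qz' + Qd' - Qz) ≤ 1 / 4 * Gd)
    (hD : σ * ⟪(τ - 1) • r + r', b' - b⟫ + 1 / 2 * Qd' - 1 / 2 * Qd ≤ 0) :
    (1 / (τ * σ) * ‖ξ'‖ ^ 2 + Py' + Qz' + σ * ‖b'‖ ^ 2 + Qd' + σ * β * ‖r'‖ ^ 2)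
      + (σ * ε * ‖r'‖ ^ 2 + σ * ε * ‖b' - b‖ ^ 2 + (Pd - 1 / 2 * Fd) + (Qd' - 1 / 2 * Gd))
      ≤ 1 / (τ * σ) * ‖ξ‖ ^ 2 + Py + Qz + σ * ‖b‖ ^ 2 + Qd + σ * β * ‖r‖ ^ 2 := by
  have hquad : 0 ≤ ‖b' - b‖ ^ 2 + 2 * (τ - 1) * ⟪r, b' - b⟫ + β * ‖r‖ ^ 2 - ε * ‖b' - b‖ ^ 2 := by
    have h := sq_nonneg ‖β • r + (τ - 1) • (b' - b)‖
    rw [norm_add_sq_real, norm_smul, norm_smul, mul_pow, mul_pow, Real.norm_eq_abs,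
      Real.norm_eq_abs, sq_abs, sq_abs, inner_smul_left, inner_smul_right, conj_trivial] at h
    refine nonneg_of_mul_nonneg_right (a := β) ?_ hβ
    nlinarith [sq_nonneg ‖b' - b‖, mul_le_mul_of_nonneg_right hε (sq_nonneg ‖b' - b‖)]
  have hx : 1 / (τ * σ) * ‖ξ'‖ ^ 2
      = 1 / (τ * σ) * ‖ξ‖ ^ 2 + 2 * ⟪ξ, r'⟫ + τ * σ * ‖r'‖ ^ 2 := by
    rw [hξ, norm_add_sq_real, norm_smul, mul_pow, Real.norm_eq_abs, sq_abs, inner_smul_right]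
    field_simp
  have hα : α = r' - b' := by rw [hr', add_sub_cancel_right]
  have hsq := mul_le_mul_of_nonneg_right hβε (mul_nonneg hσ.le (sq_nonneg ‖r'‖))
  have hqs := mul_nonneg hσ.le hquad
  have hbb : ‖b' - b‖ ^ 2 = ‖b'‖ ^ 2 - 2 * ⟪b', b⟫ + ‖b‖ ^ 2 := norm_sub_sq_real _ _
  rw [hx]
  subst hα
  simp only [inner_add_left, inner_smul_left, inner_sub_left, inner_sub_right,
    real_inner_self_eq_norm_sq, conj_trivial] at hY hZ hD hqs
  rw [real_inner_comm r' b', real_inner_comm r' b, real_inner_comm b' b] at *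
  nlinarith

open Filter Topology in
/-- In a nonnegative Lyapunov inequality the dissipation tends to zero. -/
lemma tendsto_dissipation_zero {V D : ℕ → ℝ} (hV : ∀ k, 0 ≤ V k) (hD : ∀ k, 0 ≤ D k)
    (h : ∀ k, V (k + 1) + D k ≤ V k) : Tendsto D atTop (𝓝 0) := by
  have hanti : Antitone V := antitone_nat_of_succ_le fun k => by linarith [h k, hD k]
  have hlim := tendsto_atTop_ciInf hanti ⟨0, by rintro _ ⟨k, rfl⟩; exact hV k⟩
  have hdiff : Tendsto (fun k => V k - V (k + 1)) atTop (𝓝 0) := by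
    simpa using hlim.sub (hlim.comp (tendsto_add_atTop_nat 1))
  exact squeeze_zero hD (fun k => by linarith [h k]) hdiff

section Lyapunov

variable {X Y Z : Type*}
  [NormedAddCommGroup X] [InnerProductSpace ℝ X] [FiniteDimensional ℝ X]
  [NormedAddCommGroup Y] [InnerProductSpace ℝ Y] [FiniteDimensional ℝ Y]
  [NormedAddCommGroup Z] [InnerProductSpace ℝ Z] [FiniteDimensional ℝ Z]

/-- The Lyapunov function of the alternating scheme with proximal operators `P` and `Q`, relative
to the reference point `ū`, at the iterate `u = (y, z, x)` whose previous `z`-component is `z₀`. -/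
def admmLyapunov (A : X →ₗ[ℝ] Y) (B : X →ₗ[ℝ] Z) (c : X) (P : Y →ₗ[ℝ] Y) (Q : Z →ₗ[ℝ] Z)
    (σ τ β : ℝ) (ū : Y × Z × X) (z₀ : Z) (u : Y × Z × X) : ℝ :=
  1 / (τ * σ) * ‖u.2.2 - ū.2.2‖ ^ 2 + quadForm P (u.1 - ū.1) + quadForm Q (u.2.1 - ū.2.1)
    + σ * ‖LinearMap.adjoint B (u.2.1 - ū.2.1)‖ ^ 2 + quadForm Q (u.2.1 - z₀)
    + σ * β * ‖LinearMap.adjoint A u.1 + LinearMap.adjoint B u.2.1 - c‖ ^ 2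

variable {A : X →ₗ[ℝ] Y} {B : X →ₗ[ℝ] Z} {c : X} {P : Y →ₗ[ℝ] Y} {Q : Z →ₗ[ℝ] Z} {σ τ β : ℝ}

lemma admmLyapunov_nonneg (hP : ∀ w, 0 ≤ quadForm P w) (hQ : ∀ w, 0 ≤ quadForm Q w)
    (hσ : 0 < σ) (hτ : 0 < τ) (hβ : 0 < β) (ū : Y × Z × X) (z₀ : Z) (u : Y × Z × X) :
    0 ≤ admmLyapunov A B c P Q σ τ β ū z₀ u := by
  have h1 := hP (u.1 - ū.1)
  have h2 := hQ (u.2.1 - ū.2.1)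
  have h3 := hQ (u.2.1 - z₀)
  rw [admmLyapunov]
  positivity

lemma continuous_admmLyapunov (ū : Y × Z × X) :
    Continuous fun v : Z × Y × Z × X => admmLyapunov A B c P Q σ τ β ū v.1 v.2 := by
  have hP := continuous_quadForm P
  have hQ := continuous_quadForm Q
  have hA := (LinearMap.adjoint A).continuous_of_finiteDimensional
  have hB := (LinearMap.adjoint B).continuous_of_finiteDimensional
  unfold admmLyapunov
  fun_prop

lemma admmLyapunov_self {ū : Y × Z × X}
    (hū : LinearMap.adjoint A ū.1 + LinearMap.adjoint B ū.2.1 = c) :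
    admmLyapunov A B c P Q σ τ β ū ū.2.1 ū = 0 := by
  simp [admmLyapunov, quadForm_zero, hū]

/-- The Lyapunov function controls the squared distance to a feasible reference point. -/
lemma exists_norm_sq_le_admmLyapunov (hP : ∀ w, 0 ≤ quadForm P w)
    (hQ : ∀ w, 0 ≤ quadForm Q w) (hσ : 0 < σ) (hτ : 0 < τ) (hβ : 0 < β) {mY mZ : ℝ}
    (hmY : 0 < mY) (hmZ : 0 < mZ)
    (hcY : ∀ w, mY * ‖w‖ ^ 2 ≤ quadForm P w + σ * ‖LinearMap.adjoint A w‖ ^ 2)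
    (hcZ : ∀ w, mZ * ‖w‖ ^ 2 ≤ quadForm Q w + σ * ‖LinearMap.adjoint B w‖ ^ 2) :
    ∃ K : ℝ, 0 < K ∧ ∀ (ū u : Y × Z × X) (z₀ : Z),
      LinearMap.adjoint A ū.1 + LinearMap.adjoint B ū.2.1 = c →
      ‖u - ū‖ ^ 2 ≤ K * admmLyapunov A B c P Q σ τ β ū z₀ u := by
  refine ⟨τ * σ + 1 / mZ + (3 + 2 / β) / mY, by positivity, fun ū u z₀ hū => ?_⟩
  set V := admmLyapunov A B c P Q σ τ β ū z₀ u with hV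
  have hV0 : 0 ≤ V := admmLyapunov_nonneg hP hQ hσ hτ hβ ū z₀ u
  have hVe := hV
  rw [admmLyapunov] at hVe
  set r := LinearMap.adjoint A u.1 + LinearMap.adjoint B u.2.1 - c with hr
  have h1 := hP (u.1 - ū.1)
  have h2 := hQ (u.2.1 - ū.2.1)
  have h3 := hQ (u.2.1 - z₀)
  have h4 : 0 ≤ 1 / (τ * σ) * ‖u.2.2 - ū.2.2‖ ^ 2 := by positivity
  have h5 : 0 ≤ σ * ‖LinearMap.adjoint B (u.2.1 - ū.2.1)‖ ^ 2 := by positivity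
  have h6 : 0 ≤ σ * β * ‖r‖ ^ 2 := by positivity
  have hx : ‖u.2.2 - ū.2.2‖ ^ 2 ≤ τ * σ * V := by
    have : 1 / (τ * σ) * ‖u.2.2 - ū.2.2‖ ^ 2 ≤ V := by linarith
    rw [one_div, inv_mul_le_iff₀ (by positivity)] at this
    exact this
  have hz : ‖u.2.1 - ū.2.1‖ ^ 2 ≤ 1 / mZ * V := by
    have := (hcZ (u.2.1 - ū.2.1)).trans (show _ ≤ V by linarith)
    rw [one_div, le_inv_mul_iff₀ hmZ]
    exact this
  have hy : ‖u.1 - ū.1‖ ^ 2 ≤ (3 + 2 / β) / mY * V := by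
    have hA : LinearMap.adjoint A (u.1 - ū.1) = r - LinearMap.adjoint B (u.2.1 - ū.2.1) := by
      rw [hr, ← hū, map_sub, map_sub]; abel
    have hn : ‖LinearMap.adjoint A (u.1 - ū.1)‖ ^ 2
        ≤ 2 * ‖r‖ ^ 2 + 2 * ‖LinearMap.adjoint B (u.2.1 - ū.2.1)‖ ^ 2 := by
      rw [hA]
      have := parallelogram_law_with_norm ℝ r (LinearMap.adjoint B (u.2.1 - ū.2.1))
      nlinarith [sq_nonneg ‖r + LinearMap.adjoint B (u.2.1 - ū.2.1)‖]
    have hσn := mul_le_mul_of_nonneg_left hn hσ.le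
    have hrV : σ * ‖r‖ ^ 2 ≤ 1 / β * V := by
      rw [one_div, le_inv_mul_iff₀ hβ]
      linarith
    have h := hcY (u.1 - ū.1)
    have hmul : mY * ‖u.1 - ū.1‖ ^ 2 ≤ (3 + 2 / β) * V := by
      have : (3 + 2 / β) * V = 3 * V + 2 * (1 / β * V) := by ring
      linarith
    rw [div_mul_eq_mul_div, le_div_iff₀ hmY]
    linarith
  have hKx : 0 ≤ τ * σ * V := by positivity
  have hKz : 0 ≤ 1 / mZ * V := by positivity
  have hKy : 0 ≤ (3 + 2 / β) / mY * V := by positivity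
  have hle : ‖u - ū‖ ≤ Real.sqrt ((τ * σ + 1 / mZ + (3 + 2 / β) / mY) * V) := by
    rw [Prod.norm_def, Prod.norm_def]
    refine max_le ?_ (max_le ?_ ?_) <;> apply Real.le_sqrt_of_sq_le
    · change ‖u.1 - ū.1‖ ^ 2 ≤ _
      linarith
    · change ‖u.2.1 - ū.2.1‖ ^ 2 ≤ _
      linarith
    · change ‖u.2.2 - ū.2.2‖ ^ 2 ≤ _
      linarith
  calc ‖u - ū‖ ^ 2 ≤ Real.sqrt ((τ * σ + 1 / mZ + (3 + 2 / β) / mY) * V) ^ 2 := by gcongr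
    _ = _ := Real.sq_sqrt (by positivity)

/-- The Lyapunov function decreases along the optimality conditions of two successive steps. -/
lemma admmLyapunov_decrease {ε : ℝ} (hσ : 0 < σ) (hτ : 0 < τ) (hβ : 0 < β)
    (hβε : β + ε ≤ 2 - τ) (hε : (τ - 1) ^ 2 ≤ (1 - ε) * β)
    {f : Y → ℝ} {g : Z → ℝ} {gradf : Y → Y} {gradg : Z → Z} {p : Y → EReal} {q : Z → EReal}
    (hp : ERProper p) (hq : ERProper q) {F S : Y →ₗ[ℝ] Y} {G T : Z →ₗ[ℝ] Z}
    (hF : F.IsSymmetric) (hS : S.IsSymmetric) (hG : G.IsSymmetric) (hTs : T.IsSymmetric)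
    (hT : ∀ w, -(1 / 2) * quadForm G w ≤ quadForm T w)
    (hflow : ∀ w w', f w' + ⟪gradf w', w - w'⟫ ≤ f w)
    (hfup : ∀ w w', f w ≤ f w' + ⟪gradf w', w - w'⟫ + 1 / 2 * quadForm F (w - w'))
    (hglow : ∀ w w', g w' + ⟪gradg w', w - w'⟫ ≤ g w)
    (hgup : ∀ w w', g w ≤ g w' + ⟪gradg w', w - w'⟫ + 1 / 2 * quadForm G (w - w'))
    {ū : Y × Z × X} (hū : ū ∈ KKTset A B c gradf gradg p q)
    {y y' : Y} {z₀ z z' : Z} {x₀ x x' : X}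
    (hY : ERSubgrad p y' (-(gradf y + A x
      + σ • A (LinearMap.adjoint A y' + (LinearMap.adjoint B z - c)) + (F + S) (y' - y))))
    (hZ₀ : ERSubgrad q z (-(gradg z₀ + B x₀
      + σ • B (LinearMap.adjoint B z + (LinearMap.adjoint A y - c)) + (G + T) (z - z₀))))
    (hZ : ERSubgrad q z' (-(gradg z + B x
      + σ • B (LinearMap.adjoint B z' + (LinearMap.adjoint A y' - c)) + (G + T) (z' - z))))
    (hx : x = x₀ + (τ * σ) • (LinearMap.adjoint A y + LinearMap.adjoint B z - c))
    (hx' : x' = x + (τ * σ) • (LinearMap.adjoint A y' + LinearMap.adjoint B z' - c)) :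
    admmLyapunov A B c (F + S) (G + T) σ τ β ū z (y', z', x')
      + (σ * ε * ‖LinearMap.adjoint A y' + LinearMap.adjoint B z' - c‖ ^ 2
        + σ * ε * ‖LinearMap.adjoint B (z' - z)‖ ^ 2
        + (quadForm (F + S) (y' - y) - 1 / 2 * quadForm F (y' - y))
        + (quadForm (G + T) (z' - z) - 1 / 2 * quadForm G (z' - z)))
      ≤ admmLyapunov A B c (F + S) (G + T) σ τ β ū z₀ (y, z, x) := by
  obtain ⟨yb, zb, xb⟩ := ū
  obtain ⟨hKY, hKZ, hfeas⟩ := hū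
  dsimp only at hKY hKZ hfeas
  have eb : LinearMap.adjoint B (z' - z)
      = LinearMap.adjoint B (z' - zb) - LinearMap.adjoint B (z - zb) := by
    rw [← map_sub]; congr 1; abel
  rw [eb]
  have eY : ∀ w v, LinearMap.adjoint A w + (LinearMap.adjoint B v - c)
      = LinearMap.adjoint A (w - yb) + LinearMap.adjoint B (v - zb) := by
    intro w v
    rw [← hfeas, map_sub, map_sub]; abel
  have eR : LinearMap.adjoint B z' + (LinearMap.adjoint A y' - c)
      = LinearMap.adjoint A y' + LinearMap.adjoint B z' - c := by abel
  have eR₀ : LinearMap.adjoint B z + (LinearMap.adjoint A y - c)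
      = LinearMap.adjoint A y + LinearMap.adjoint B z - c := by abel
  rw [eR] at hZ
  rw [eR₀] at hZ₀
  refine lyapunov_decrease (ξ := x - xb) (α := LinearMap.adjoint A (y' - yb))
    (r := LinearMap.adjoint A y + LinearMap.adjoint B z - c) hσ hτ hβ hβε hε ?_ ?_ ?_ ?_ ?_
  · rw [← eY y' z']; abel
  · dsimp only
    rw [hx']; abel
  · have hm := hY.inner_nonneg hp hKY
    have h3 := three_point_gradient_bound hflow hfup y yb y'
    have hpol := (hF.add hS).inner_map_sub_sub y y' yb
    have e : -(gradf y + A x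
        + σ • A (LinearMap.adjoint A y' + (LinearMap.adjoint B z - c)) + (F + S) (y' - y))
        - -(gradf yb + A xb)
        = -((gradf y - gradf yb) + A ((x - xb)
          + σ • (LinearMap.adjoint A (y' - yb) + LinearMap.adjoint B (z - zb)))
          + (F + S) (y' - y)) := by
      rw [← eY y' z, map_add A (x - xb), map_sub A x xb, map_smul]; abel
    rw [e, inner_neg_left, inner_add_left, inner_add_left, ← LinearMap.adjoint_inner_right A] at hm
    linarith
  · have hm := hZ.inner_nonneg hq hKZ
    have h3 := three_point_gradient_bound hglow hgup z zb z'
    have hpol := (hG.add hTs).inner_map_sub_sub z z' zb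
    have e : -(gradg z + B x
        + σ • B (LinearMap.adjoint A y' + LinearMap.adjoint B z' - c) + (G + T) (z' - z))
        - -(gradg zb + B xb)
        = -((gradg z - gradg zb) + B ((x - xb)
          + σ • (LinearMap.adjoint A y' + LinearMap.adjoint B z' - c))
          + (G + T) (z' - z)) := by
      rw [map_add B (x - xb), map_sub B x xb, map_smul]; abel
    rw [e, inner_neg_left, inner_add_left, inner_add_left, ← LinearMap.adjoint_inner_right B] at hm
    linarith
  · have hm := hZ.inner_nonneg hq hZ₀
    have h3 := inner_proximal_gradient_bound hG hTs hT hglow hgup z z₀ (z' - z)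
    set r := LinearMap.adjoint A y + LinearMap.adjoint B z - c with hr
    set r' := LinearMap.adjoint A y' + LinearMap.adjoint B z' - c with hr'
    have e : -(gradg z + B x + σ • B r' + (G + T) (z' - z))
        - -(gradg z₀ + B x₀ + σ • B r + (G + T) (z - z₀))
        = -((gradg z - gradg z₀) + B (σ • ((τ - 1) • r + r'))
          + (G + T) (z' - z) - (G + T) (z - z₀)) := by
      rw [hx]
      simp only [map_add, map_smul]
      module
    rw [e, inner_neg_left, inner_sub_left, inner_add_left, inner_add_left,
      ← LinearMap.adjoint_inner_right B, inner_smul_left, conj_trivial,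
      real_inner_comm (z' - z) ((G + T) (z' - z)), ← quadForm, eb] at hm
    dsimp only
    linarith

/-- The primal part of a KKT point solves the constrained convex problem. -/
lemma KKTset.isMin {f : Y → ℝ} {g : Z → ℝ} {gradf : Y → Y} {gradg : Z → Z} {p : Y → EReal}
    {q : Z → EReal} (hp : ERProper p) (hq : ERProper q)
    (hflow : ∀ w w', f w' + ⟪gradf w', w - w'⟫ ≤ f w)
    (hglow : ∀ w w', g w' + ⟪gradg w', w - w'⟫ ≤ g w)
    {yb : Y} {zb : Z} {xb : X} (h : (yb, zb, xb) ∈ KKTset A B c gradf gradg p q) (w : Y) (v : Z)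
    (hwv : LinearMap.adjoint A w + LinearMap.adjoint B v = c) :
    p yb + ((f yb : ℝ) : EReal) + q zb + ((g zb : ℝ) : EReal)
      ≤ p w + ((f w : ℝ) : EReal) + q v + ((g v : ℝ) : EReal) := by
  obtain ⟨hY, hZ, hfeas⟩ := h
  dsimp only at hY hZ hfeas
  have hqv : ∀ a : EReal, a ≠ ⊥ → ∀ b : ℝ, a + (b : EReal) ≠ ⊥ := fun a ha b =>
    EReal.add_ne_bot_iff.mpr ⟨ha, EReal.coe_ne_bot b⟩
  by_cases hw : p w = ⊤
  · rw [hw, EReal.top_add_coe, EReal.top_add_of_ne_bot (hq.2 v), EReal.top_add_coe]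
    exact le_top
  by_cases hv : q v = ⊤
  · rw [hv, EReal.add_top_of_ne_bot (hqv _ (hp.2 w) _), EReal.top_add_coe]
    exact le_top
  have h1 := hY.toReal_le hp hw
  have h2 := hZ.toReal_le hq hv
  have h3 := hflow w yb
  have h4 := hglow v zb
  have h5 : ⟪A xb, w - yb⟫ + ⟪B xb, v - zb⟫ = 0 := by
    rw [← LinearMap.adjoint_inner_right, ← LinearMap.adjoint_inner_right, ← inner_add_right,
      map_sub, map_sub, sub_add_sub_comm, hwv, hfeas, sub_self, inner_zero_right]
  rw [inner_neg_left, inner_add_left] at h1 h2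
  rw [← EReal.coe_toReal hw (hp.2 w), ← EReal.coe_toReal hv (hq.2 v),
    ← EReal.coe_toReal (hY.ne_top hp) (hp.2 yb), ← EReal.coe_toReal (hZ.ne_top hq) (hq.2 zb)]
  norm_cast
  linarith

end Lyapunov

open Filter Topology in
lemma tendsto_zero_of_mul_norm_sq_le {E : Type*} [NormedAddCommGroup E] {m : ℝ} (hm : 0 < m)
    {w : ℕ → E} {a : ℕ → ℝ} (h : ∀ k, m * ‖w k‖ ^ 2 ≤ a k) (ha : Tendsto a atTop (𝓝 0)) :
    Tendsto w atTop (𝓝 0) := by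
  rw [tendsto_zero_iff_norm_tendsto_zero]
  have hsq : Tendsto (fun k => ‖w k‖ ^ 2) atTop (𝓝 0) := by
    refine squeeze_zero (fun k => by positivity) (fun k => ?_)
      (by simpa using ha.const_mul m⁻¹)
    rw [le_inv_mul_iff₀ hm]
    exact h k
  simpa [Real.sqrt_sq (norm_nonneg _)] using hsq.sqrt


open Filter Topology in
/-- **Theorem 3.1 (a).**  For `τ ∈ (0, (1+√5)/2)`, if `½Σ̂_f + 𝒮 + σ𝒜𝒜* ≻ 0` and
`½Σ̂_g + 𝒯 + σℬℬ* ≻ 0`, then the sequence generated by the majorized iPADMM converges to a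
KKT point `u^∞ = (y^∞, z^∞, x^∞)`; in particular `(y^∞, z^∞)` is an optimal solution of
`min p(y) + f(y) + q(z) + g(z)` subject to `𝒜*y + ℬ*z = c`. -/
theorem stmt7 {X Y Z : Type*}
    [NormedAddCommGroup X] [InnerProductSpace ℝ X] [FiniteDimensional ℝ X]
    [NormedAddCommGroup Y] [InnerProductSpace ℝ Y] [FiniteDimensional ℝ Y]
    [NormedAddCommGroup Z] [InnerProductSpace ℝ Z] [FiniteDimensional ℝ Z]
    (A : X →ₗ[ℝ] Y) (B : X →ₗ[ℝ] Z) (c : X)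
    (f : Y → ℝ) (g : Z → ℝ) (gradf : Y → Y) (gradg : Z → Z)
    (hfconv : ConvexOn ℝ Set.univ f) (hgconv : ConvexOn ℝ Set.univ g)
    (hfdiff : ∀ w, HasGradientAt f (gradf w) w)
    (hgdiff : ∀ w, HasGradientAt g (gradg w) w)
    (hfLip : ∃ L : NNReal, LipschitzWith L gradf)
    (hgLip : ∃ L : NNReal, LipschitzWith L gradg)
    (p : Y → EReal) (q : Z → EReal)
    (hpconv : ERConvex p) (hplsc : LowerSemicontinuous p) (hpproper : ERProper p)
    (hqconv : ERConvex q) (hqlsc : LowerSemicontinuous q) (hqproper : ERProper q)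
    (Sf Sfh : Y →ₗ[ℝ] Y) (Sg Sgh : Z →ₗ[ℝ] Z)
    (hSfsym : Sf.IsSymmetric) (hSfh_sym : Sfh.IsSymmetric)
    (hSgsym : Sg.IsSymmetric) (hSghsym : Sgh.IsSymmetric)
    (hSfpos : ∀ w, 0 ≤ quadForm Sf w) (hSfhpos : ∀ w, 0 ≤ quadForm Sfh w)
    (hSgpos : ∀ w, 0 ≤ quadForm Sg w) (hSghpos : ∀ w, 0 ≤ quadForm Sgh w)
    (hSfle : ∀ w, quadForm Sf w ≤ quadForm Sfh w)
    (hSgle : ∀ w, quadForm Sg w ≤ quadForm Sgh w)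
    (hfmaj : ∀ w w' : Y,
      f w' + ⟪gradf w', w - w'⟫ + 1 / 2 * quadForm Sf (w - w') ≤ f w ∧
      f w ≤ f w' + ⟪gradf w', w - w'⟫ + 1 / 2 * quadForm Sfh (w - w'))
    (hgmaj : ∀ w w' : Z,
      g w' + ⟪gradg w', w - w'⟫ + 1 / 2 * quadForm Sg (w - w') ≤ g w ∧
      g w ≤ g w' + ⟪gradg w', w - w'⟫ + 1 / 2 * quadForm Sgh (w - w'))
    (σ τ : ℝ) (hσ : 0 < σ) (hτ : 0 < τ ∧ τ < (1 + Real.sqrt 5) / 2)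
    (S : Y →ₗ[ℝ] Y) (T : Z →ₗ[ℝ] Z)
    (hSsym : S.IsSymmetric) (hTsym : T.IsSymmetric)
    (hS : ∀ w, -(1 / 2) * quadForm Sfh w ≤ quadForm S w)
    (hT : ∀ w, -(1 / 2) * quadForm Sgh w ≤ quadForm T w)
    (y : ℕ → Y) (z : ℕ → Z) (x : ℕ → X)
    (hdomp : ∀ k, p (y k) ≠ ⊤) (hdomq : ∀ k, q (z k) ≠ ⊤)
    (hsubY : ∀ k, ∀ w : Y,
      p (y (k + 1)) + ((⟪y (k + 1), gradf (y k) + A (x k)⟫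
          + σ / 2 * ‖LinearMap.adjoint A (y (k + 1)) + LinearMap.adjoint B (z k) - c‖ ^ 2
          + 1 / 2 * quadForm (Sfh + S) (y (k + 1) - y k) : ℝ) : EReal)
      ≤ p w + ((⟪w, gradf (y k) + A (x k)⟫
          + σ / 2 * ‖LinearMap.adjoint A w + LinearMap.adjoint B (z k) - c‖ ^ 2
          + 1 / 2 * quadForm (Sfh + S) (w - y k) : ℝ) : EReal))
    (hsubZ : ∀ k, ∀ w : Z,
      q (z (k + 1)) + ((⟪z (k + 1), gradg (z k) + B (x k)⟫
          + σ / 2 * ‖LinearMap.adjoint A (y (k + 1)) + LinearMap.adjoint B (z (k + 1)) - c‖ ^ 2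
          + 1 / 2 * quadForm (Sgh + T) (z (k + 1) - z k) : ℝ) : EReal)
      ≤ q w + ((⟪w, gradg (z k) + B (x k)⟫
          + σ / 2 * ‖LinearMap.adjoint A (y (k + 1)) + LinearMap.adjoint B w - c‖ ^ 2
          + 1 / 2 * quadForm (Sgh + T) (w - z k) : ℝ) : EReal))
    (hxup : ∀ k, x (k + 1)
      = x k + (τ * σ) • (LinearMap.adjoint A (y (k + 1)) + LinearMap.adjoint B (z (k + 1)) - c))
    (hKKTne : (KKTset A B c gradf gradg p q).Nonempty)
    (hposY : ∀ w : Y, w ≠ 0 →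
      0 < quadForm ((1 / 2 : ℝ) • Sfh + S + σ • (A ∘ₗ LinearMap.adjoint A)) w)
    (hposZ : ∀ w : Z, w ≠ 0 →
      0 < quadForm ((1 / 2 : ℝ) • Sgh + T + σ • (B ∘ₗ LinearMap.adjoint B)) w) :
    ∃ ylim : Y, ∃ zlim : Z, ∃ xlim : X,
      (ylim, zlim, xlim) ∈ KKTset A B c gradf gradg p q ∧
      Filter.Tendsto (fun k => (y k, z k, x k)) Filter.atTop (nhds (ylim, zlim, xlim)) ∧
      (∀ (w : Y) (v : Z), LinearMap.adjoint A w + LinearMap.adjoint B v = c →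
        p ylim + ((f ylim : ℝ) : EReal) + q zlim + ((g zlim : ℝ) : EReal)
          ≤ p w + ((f w : ℝ) : EReal) + q v + ((g v : ℝ) : EReal)) := by
  obtain ⟨hτ0, hτ1⟩ := hτ
  obtain ⟨β, ε, hβ, hε, hβε, hτε⟩ := exists_absorbing_constants hτ0 hτ1
  have hflow : ∀ w w', f w' + ⟪gradf w', w - w'⟫ ≤ f w := fun w w' => by
    linarith [(hfmaj w w').1, hSfpos (w - w')]
  have hglow : ∀ w w', g w' + ⟪gradg w', w - w'⟫ ≤ g w := fun w w' => by
    linarith [(hgmaj w w').1, hSgpos (w - w')]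
  have hPe : ∀ w, quadForm (Sfh + S) w = quadForm Sfh w + quadForm S w :=
    quadForm_add_apply Sfh S
  have hQe : ∀ w, quadForm (Sgh + T) w = quadForm Sgh w + quadForm T w :=
    quadForm_add_apply Sgh T
  have hP : ∀ w, 0 ≤ quadForm (Sfh + S) w := fun w => by linarith [hPe w, hS w, hSfhpos w]
  have hQ : ∀ w, 0 ≤ quadForm (Sgh + T) w := fun w => by linarith [hQe w, hT w, hSghpos w]
  obtain ⟨mY, hmY, hcY⟩ := exists_mul_norm_sq_le_quadForm hposY
  obtain ⟨mZ, hmZ, hcZ⟩ := exists_mul_norm_sq_le_quadForm hposZ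
  simp only [quadForm_add_apply, quadForm_smul_apply, quadForm_comp_adjoint] at hcY hcZ
  obtain ⟨K, hK, hbound⟩ := exists_norm_sq_le_admmLyapunov (A := A) (B := B) (c := c) hP hQ hσ hτ0
    hβ hmY hmZ (fun w => by linarith [hcY w, hPe w, hSfhpos w])
    (fun w => by linarith [hcZ w, hQe w, hSghpos w])
  have hgY : ∀ k, ERSubgrad p (y (k + 1)) (-(gradf (y k) + A (x k)
      + σ • A (LinearMap.adjoint A (y (k + 1)) + (LinearMap.adjoint B (z k) - c))
      + (Sfh + S) (y (k + 1) - y k))) := fun k =>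
    ERSubgrad.of_isMin hpproper hpconv A (hSfh_sym.add hSsym) _ _ _ _ (hdomp _)
      (by simpa only [← add_sub_assoc] using hsubY k)
  have hgZ : ∀ k, ERSubgrad q (z (k + 1)) (-(gradg (z k) + B (x k)
      + σ • B (LinearMap.adjoint B (z (k + 1)) + (LinearMap.adjoint A (y (k + 1)) - c))
      + (Sgh + T) (z (k + 1) - z k))) := by
    intro k
    have e : ∀ w, LinearMap.adjoint B w + (LinearMap.adjoint A (y (k + 1)) - c)
        = LinearMap.adjoint A (y (k + 1)) + LinearMap.adjoint B w - c := fun w => by abel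
    exact ERSubgrad.of_isMin hqproper hqconv B (hSghsym.add hTsym) _ _ _ _ (hdomq _)
      (by simpa only [e] using hsubZ k)
  set V : Y × Z × X → ℕ → ℝ := fun ū k =>
    admmLyapunov A B c (Sfh + S) (Sgh + T) σ τ β ū (z k) (y (k + 1), z (k + 1), x (k + 1)) with hV
  set r : ℕ → X := fun k =>
    LinearMap.adjoint A (y k) + LinearMap.adjoint B (z k) - c with hr
  set D : ℕ → ℝ := fun k => σ * ε * ‖r (k + 2)‖ ^ 2
      + σ * ε * ‖LinearMap.adjoint B (z (k + 2) - z (k + 1))‖ ^ 2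
      + (quadForm (Sfh + S) (y (k + 2) - y (k + 1)) - 1 / 2 * quadForm Sfh (y (k + 2) - y (k + 1)))
      + (quadForm (Sgh + T) (z (k + 2) - z (k + 1)) - 1 / 2 * quadForm Sgh (z (k + 2) - z (k + 1)))
    with hDdef
  have hdec : ∀ ū ∈ KKTset A B c gradf gradg p q, ∀ k, V ū (k + 1) + D k ≤ V ū k :=
    fun ū hū k => admmLyapunov_decrease hσ hτ0 hβ hβε hτε hpproper hqproper hSfh_sym hSsym hSghsym
      hTsym hT hflow (fun w w' => (hfmaj w w').2) hglow (fun w w' => (hgmaj w w').2) hū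
      (hgY (k + 1)) (hgZ k) (hgZ (k + 1)) (hxup k) (hxup (k + 1))
  have hV0 : ∀ ū k, 0 ≤ V ū k := fun ū k => admmLyapunov_nonneg hP hQ hσ hτ0 hβ ū _ _
  have hDY : ∀ w, 0 ≤ quadForm (Sfh + S) w - 1 / 2 * quadForm Sfh w := fun w => by
    linarith [hPe w, hS w]
  have hDZ : ∀ w, 0 ≤ quadForm (Sgh + T) w - 1 / 2 * quadForm Sgh w := fun w => by
    linarith [hQe w, hT w]
  have hD1 : ∀ k, 0 ≤ σ * ε * ‖r (k + 2)‖ ^ 2 := fun k => by positivity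
  have hD2 : ∀ k, 0 ≤ σ * ε * ‖LinearMap.adjoint B (z (k + 2) - z (k + 1))‖ ^ 2 :=
    fun k => by positivity
  have hD0 : ∀ k, 0 ≤ D k := fun k =>
    add_nonneg (add_nonneg (add_nonneg (hD1 k) (hD2 k)) (hDY _)) (hDZ _)
  have hanti : ∀ ū ∈ KKTset A B c gradf gradg p q, Antitone (V ū) := fun ū hū =>
    antitone_nat_of_succ_le fun k => by linarith [hdec ū hū k, hD0 k]
  obtain ⟨ū₀, hū₀⟩ := hKKTne
  have hDlim : Tendsto D atTop (𝓝 0) := tendsto_dissipation_zero (hV0 ū₀) hD0 (hdec ū₀ hū₀)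
  have hrlim : Tendsto (fun k => r (k + 2)) atTop (𝓝 0) := by
    refine tendsto_zero_of_mul_norm_sq_le (mul_pos hσ hε) (fun k => ?_) hDlim
    simp only [hDdef]
    linarith [hD2 k, hDY (y (k + 2) - y (k + 1)), hDZ (z (k + 2) - z (k + 1))]
  have hBlim : Tendsto (fun k => LinearMap.adjoint B (z (k + 2) - z (k + 1))) atTop (𝓝 0) := by
    refine tendsto_zero_of_mul_norm_sq_le (mul_pos hσ hε) (fun k => ?_) hDlim
    simp only [hDdef]
    linarith [hD1 k, hDY (y (k + 2) - y (k + 1)), hDZ (z (k + 2) - z (k + 1))]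
  have hdz : Tendsto (fun k => z (k + 2) - z (k + 1)) atTop (𝓝 0) := by
    refine tendsto_zero_of_mul_norm_sq_le hmZ
      (a := fun k => D k + σ * ‖LinearMap.adjoint B (z (k + 2) - z (k + 1))‖ ^ 2) (fun k => ?_) ?_
    · simp only [hDdef]
      linarith [hcZ (z (k + 2) - z (k + 1)), hQe (z (k + 2) - z (k + 1)), hD1 k, hD2 k,
        hDY (y (k + 2) - y (k + 1))]
    · simpa using hDlim.add ((hBlim.norm.pow 2).const_mul σ)
  have hAlim : Tendsto (fun k => LinearMap.adjoint A (y (k + 3) - y (k + 2))) atTop (𝓝 0) := by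
    have h := ((hrlim.comp (tendsto_add_atTop_nat 1)).sub hrlim).sub
      (hBlim.comp (tendsto_add_atTop_nat 1))
    simp only [sub_zero] at h
    refine h.congr fun k => ?_
    simp only [Function.comp_apply, hr, map_sub, add_assoc, Nat.reduceAdd]
    abel
  have hdy : Tendsto (fun k => y (k + 3) - y (k + 2)) atTop (𝓝 0) := by
    refine tendsto_zero_of_mul_norm_sq_le hmY (a := fun k => D (k + 1)
      + σ * ‖LinearMap.adjoint A (y (k + 3) - y (k + 2))‖ ^ 2) (fun k => ?_) ?_
    · simp only [hDdef, add_assoc, Nat.reduceAdd]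
      have h1 := hD1 (k + 1)
      have h2 := hD2 (k + 1)
      simp only [add_assoc, Nat.reduceAdd] at h1 h2
      linarith [hcY (y (k + 3) - y (k + 2)), hPe (y (k + 3) - y (k + 2)),
        hDZ (z (k + 3) - z (k + 2))]
    · simpa using (hDlim.comp (tendsto_add_atTop_nat 1)).add ((hAlim.norm.pow 2).const_mul σ)
  have hfeas₀ := hū₀.2.2
  obtain ⟨u, -, φ, hφ, hulim⟩ := tendsto_subseq_of_bounded
    (x := fun k => (y (k + 2), z (k + 2), x (k + 2)))
    (Metric.isBounded_closedBall (x := ū₀) (r := Real.sqrt (K * V ū₀ 0))) (fun k => by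
      rw [mem_closedBall_iff_norm]
      apply Real.le_sqrt_of_sq_le
      refine (hbound ū₀ _ (z (k + 1)) hfeas₀).trans ?_
      exact mul_le_mul_of_nonneg_left (hanti ū₀ hū₀ (Nat.zero_le (k + 1))) hK.le)
  obtain ⟨yl, zl, xl⟩ := u
  have hφt := hφ.tendsto_atTop
  have hy2 : Tendsto (fun n => y (φ n + 2)) atTop (𝓝 yl) := (continuous_fst.tendsto _).comp hulim
  have hz2 : Tendsto (fun n => z (φ n + 2)) atTop (𝓝 zl) :=
    ((continuous_fst.comp continuous_snd).tendsto _).comp hulim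
  have hx2 : Tendsto (fun n => x (φ n + 2)) atTop (𝓝 xl) :=
    ((continuous_snd.comp continuous_snd).tendsto _).comp hulim
  have hdy' : Tendsto (fun n => y (φ n + 3) - y (φ n + 2)) atTop (𝓝 0) := hdy.comp hφt
  have hdz' : Tendsto (fun n => z (φ n + 3) - z (φ n + 2)) atTop (𝓝 0) :=
    (hdz.comp (tendsto_add_atTop_nat 1)).comp hφt
  have hr3 : Tendsto (fun n => r (φ n + 3)) atTop (𝓝 0) :=
    (hrlim.comp (tendsto_add_atTop_nat 1)).comp hφt
  have hy3 : Tendsto (fun n => y (φ n + 3)) atTop (𝓝 yl) := by simpa using hdy'.add hy2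
  have hz3 : Tendsto (fun n => z (φ n + 3)) atTop (𝓝 zl) := by simpa using hdz'.add hz2
  have hx3 : Tendsto (fun n => x (φ n + 3)) atTop (𝓝 xl) := by
    have h := hx2.add (hr3.const_smul (τ * σ))
    rw [smul_zero, add_zero] at h
    exact h.congr fun n => (hxup (φ n + 2)).symm
  have hA := A.continuous_of_finiteDimensional
  have hB := B.continuous_of_finiteDimensional
  have hAs := (LinearMap.adjoint A).continuous_of_finiteDimensional
  have hBs := (LinearMap.adjoint B).continuous_of_finiteDimensional
  have hPc := (Sfh + S).continuous_of_finiteDimensional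
  have hQc := (Sgh + T).continuous_of_finiteDimensional
  have hgfc : Continuous gradf := hfLip.elim fun _ h => h.continuous
  have hggc : Continuous gradg := hgLip.elim fun _ h => h.continuous
  have hfeas : LinearMap.adjoint A yl + LinearMap.adjoint B zl = c := by
    have h : Tendsto (fun n => r (φ n + 3)) atTop
        (𝓝 (LinearMap.adjoint A yl + LinearMap.adjoint B zl - c)) :=
      (((hAs.tendsto _).comp hy3).add ((hBs.tendsto _).comp hz3)).sub tendsto_const_nhds
    exact sub_eq_zero.mp (tendsto_nhds_unique h hr3)
  have hKKT : (yl, zl, xl) ∈ KKTset A B c gradf gradg p q := by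
    refine ⟨?_, ?_, hfeas⟩
    · refine ERSubgrad.of_tendsto hpproper hplsc (fun n => hgY (φ n + 2)) hy3 ?_
      have hs : LinearMap.adjoint A yl + (LinearMap.adjoint B zl - c) = 0 := by
        rw [← add_sub_assoc, hfeas, sub_self]
      have h := (((((hgfc.tendsto _).comp hy2).add ((hA.tendsto _).comp hx2)).add
        (((hA.tendsto _).comp (((hAs.tendsto _).comp hy3).add
          (((hBs.tendsto _).comp hz2).sub_const c))).const_smul σ)).add
        ((hPc.tendsto _).comp hdy')).neg
      simp only [hs, map_zero, smul_zero, add_zero] at h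
      exact h
    · refine ERSubgrad.of_tendsto hqproper hqlsc (fun n => hgZ (φ n + 2)) hz3 ?_
      have hs : LinearMap.adjoint B zl + (LinearMap.adjoint A yl - c) = 0 := by
        rw [← add_sub_assoc, add_comm, hfeas, sub_self]
      have h := (((((hggc.tendsto _).comp hz2).add ((hB.tendsto _).comp hx2)).add
        (((hB.tendsto _).comp (((hBs.tendsto _).comp hz3).add
          (((hAs.tendsto _).comp hy3).sub_const c))).const_smul σ)).add
        ((hQc.tendsto _).comp hdz')).neg
      simp only [hs, map_zero, smul_zero, add_zero] at h
      exact h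
  have hVsub : Tendsto (fun n => V (yl, zl, xl) (φ n + 2)) atTop (𝓝 0) := by
    have h := ((continuous_admmLyapunov (A := A) (B := B) (c := c) (P := Sfh + S) (Q := Sgh + T)
      (σ := σ) (τ := τ) (β := β) (yl, zl, xl)).tendsto (zl, yl, zl, xl)).comp
      (hz2.prodMk_nhds (hy3.prodMk_nhds (hz3.prodMk_nhds hx3)))
    have h0 := admmLyapunov_self (P := Sfh + S) (Q := Sgh + T) (σ := σ) (τ := τ) (β := β)
      (ū := (yl, zl, xl)) hfeas
    simp only at h0
    rw [h0] at h
    exact h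
  have hVlim : Tendsto (V (yl, zl, xl)) atTop (𝓝 0) :=
    (tendsto_iff_tendsto_subseq_of_antitone (hanti _ hKKT)
      ((tendsto_add_atTop_nat 2).comp hφt)).mpr hVsub
  have hconv : Tendsto (fun k => (y (k + 1), z (k + 1), x (k + 1)) - (yl, zl, xl)) atTop (𝓝 0) :=
    tendsto_zero_of_mul_norm_sq_le one_pos (a := fun k => K * V (yl, zl, xl) k)
      (fun k => by rw [one_mul]; exact hbound (yl, zl, xl) _ (z k) hfeas)
      (by simpa using hVlim.const_mul K)
  refine ⟨yl, zl, xl, hKKT, ?_, KKTset.isMin hpproper hqproper hflow hglow hKKT⟩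
  rw [← tendsto_add_atTop_iff_nat 1]
  exact tendsto_sub_nhds_zero_iff.mp hconv

end
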